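/- Let (G,+) be a finite Abelian group with |G| = q, and let ℋ_ch(G) denote the set of characteristic subgroups of G. Every automorphic-symmetric channel W : G → 𝒴 satisfying the background polarization property ℋ_ch(G)-polarizes: for every δ > 0, lim_{n→∞} 2^{−n}·|{s ∈ {−,+}ⁿ : ∃ a characteristic subgroup H of G such that W^s is δ-determined by H}| = 1. -/

import Mathlib

open scoped Classical

noncomputable section

universe u v

/-- A (discrete memoryless) channel with input alphabet `X` and finite output alphabet `Y`:
nonnegative entries and each row sums to `1`. -/
def IsChannel {X : Type*} {Y : Type*} [Fintype Y] (W : X → Y → ℝ) : Prop :=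
  (∀ x y, 0 ≤ W x y) ∧ ∀ x, ∑ y, W x y = 1

/-- The symmetric capacity of a channel: the mutual information between a uniformly
distributed input and the corresponding output (terms with `W x y = 0` vanish). -/
def capacity {X : Type*} {Y : Type*} [Fintype X] [Fintype Y] (W : X → Y → ℝ) : ℝ :=
  ∑ y : Y, ∑ x : X, (1 / (Fintype.card X : ℝ)) * W x y *
    Real.log (W x y / ((1 / (Fintype.card X : ℝ)) * ∑ x' : X, W x' y))

/-- The quotient channel `W[H] : G ⧸ H → Y`, `W[H](y|A) = (1/|H|) ∑_{x ∈ A} W(y|x)`. -/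
def quotientChannel {G : Type*} [AddCommGroup G] [Fintype G] (H : AddSubgroup G)
    {Y : Type*} (W : G → Y → ℝ) : G ⧸ H → Y → ℝ :=
  fun A y => (1 / (Nat.card H : ℝ)) * ∑ x : G, if (x : G ⧸ H) = A then W x y else 0

/-- `W` is `δ`-determined by the subgroup `H`:
`|I(W) − log|G/H|| < δ` and `|I(W[H]) − log|G/H|| < δ`. -/
def DeterminedBy {G : Type*} [AddCommGroup G] [Fintype G] {Y : Type*} [Fintype Y]
    (W : G → Y → ℝ) (H : AddSubgroup G) (δ : ℝ) : Prop :=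
  |capacity W - Real.log (Nat.card (G ⧸ H))| < δ ∧
  |capacity (quotientChannel H W) - Real.log (Nat.card (G ⧸ H))| < δ

/-- The "minus" Arıkan transform `W⁻(y₁,y₂|u₁) = (1/q) ∑_{u₂} W(y₁|u₁+u₂) W(y₂|u₂)`. -/
def minusChannel {G : Type*} [AddCommGroup G] [Fintype G] {Y : Type*}
    (W : G → Y → ℝ) : G → Y × Y → ℝ :=
  fun u₁ y => (1 / (Fintype.card G : ℝ)) * ∑ u₂ : G, W (u₁ + u₂) y.1 * W u₂ y.2

/-- The "plus" Arıkan transform `W⁺(y₁,y₂,u₁|u₂) = (1/q) W(y₁|u₁+u₂) W(y₂|u₂)`;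
the output `(y₁, y₂, u₁)` is encoded as `((y₁, y₂), u₁)`. -/
def plusChannel {G : Type*} [AddCommGroup G] [Fintype G] {Y : Type*}
    (W : G → Y → ℝ) : G → (Y × Y) × G → ℝ :=
  fun u₂ z => (1 / (Fintype.card G : ℝ)) * W (z.2 + u₂) z.1.1 * W u₂ z.1.2

/-- `W` is degraded from `W'`: `W` is obtained from `W'` by composing with a channel `V`. -/
def DegradedFrom {X : Type*} {Y Y' : Type*} [Fintype Y] [Fintype Y'] (W : X → Y → ℝ)
    (W' : X → Y' → ℝ) : Prop :=
  ∃ V : Y' → Y → ℝ, IsChannel V ∧ ∀ x y, W x y = ∑ y' : Y', W' x y' * V y' y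

/-- Channel equivalence: mutual degradation. -/
def EquivalentChannels {X : Type*} {Y Y' : Type*} [Fintype Y] [Fintype Y'] (W : X → Y → ℝ)
    (W' : X → Y' → ℝ) : Prop :=
  DegradedFrom W W' ∧ DegradedFrom W' W

/-- The erasure channel of input alphabet `A` and parameter `ε`; the output alphabet is
`A ∪ {e}`, modelled as `Option A` with `none` as the erasure symbol `e`. For `A = G` this is
the `q`-ary erasure channel `qEC(ε)`. -/
def erasureChannel (A : Type*) (ε : ℝ) : A → Option A → ℝ :=
  fun x y => match y with
    | some z => if z = x then 1 - ε else 0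
    | none => ε

/-- `W : G → Y → ℝ` is a generalized `q`-symmetric channel. -/
def IsGeneralizedSymmetric {G : Type u} [Fintype G] {Y : Type v} [Fintype Y]
    (W : G → Y → ℝ) : Prop :=
  ∃ (Z : Type v) (_ : Fintype Z) (π : G × Z ≃ Y) (p : Z → ℝ) (ε : Z → ℝ),
    (∀ z, 0 ≤ p z) ∧ (∑ z, p z = 1) ∧
    (∀ z, 0 ≤ ε z) ∧ (∀ z, ε z ≤ 1 / ((Fintype.card G : ℝ) - 1)) ∧
    ∀ x x' z, W x (π (x', z)) =
      if x' = x then p z * (1 - ((Fintype.card G : ℝ) - 1) * ε z) else p z * ε z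

/-- `W` is automorphic-symmetric with respect to `(G,+)`: for every automorphism `f` of `G`
there is a bijection `π_f` of the output alphabet with `W(π_f(y)|f(x)) = W(y|x)`. -/
def IsAutSymmetric {G : Type*} [AddCommGroup G] {Y : Type*} (W : G → Y → ℝ) : Prop :=
  ∀ f : G ≃+ G, ∃ π : Y ≃ Y, ∀ x y, W (f x) (π y) = W x y

/-- A channel with input alphabet `G`, packaged with its (finite) output alphabet. -/
structure Channel (G : Type u) where
  Out : Type u
  [fin : Fintype Out]
  prob : G → Out → ℝ

attribute [instance] Channel.fin

def Channel.minus {G : Type u} [AddCommGroup G] [Fintype G] (C : Channel G) : Channel G :=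
  ⟨C.Out × C.Out, minusChannel C.prob⟩

def Channel.plus {G : Type u} [AddCommGroup G] [Fintype G] (C : Channel G) : Channel G :=
  ⟨(C.Out × C.Out) × G, plusChannel C.prob⟩

/-- `C.polar s` is the synthetic channel `W^s`, where `false` encodes `-`, `true` encodes `+`,
and the head of the list is the first transform applied. -/
def Channel.polar {G : Type u} [AddCommGroup G] [Fintype G] (C : Channel G) :
    List Bool → Channel G
  | [] => C
  | b :: s => (cond b C.plus C.minus).polar s

/-- `C` `𝓗`-polarizes: for every `δ > 0`, the fraction of `s ∈ {−,+}ⁿ` such that `W^s` is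
`δ`-determined by some subgroup in `𝓗` tends to `1` as `n → ∞`. Taking `𝓗` to be the set of
all subgroups gives the background (multilevel) polarization property. -/
def Polarizes {G : Type u} [AddCommGroup G] [Fintype G] (C : Channel G)
    (𝓗 : Set (AddSubgroup G)) : Prop :=
  ∀ δ > (0 : ℝ), Filter.Tendsto
    (fun n : ℕ => ((Finset.univ.filter (fun s : Fin n → Bool =>
        ∃ H ∈ 𝓗, DeterminedBy (C.polar (List.ofFn s)).prob H δ)).card : ℝ) / 2 ^ n)
    Filter.atTop (nhds 1)

theorem IsChannel.minus {G : Type u} [AddCommGroup G] [Fintype G] {C : Channel G}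
    (h : IsChannel C.prob) : IsChannel C.minus.prob := by
  have hq : (Fintype.card G : ℝ) ≠ 0 := Nat.cast_ne_zero.mpr Fintype.card_ne_zero
  refine ⟨fun x y => mul_nonneg (by positivity)
    (Finset.sum_nonneg fun u _ => mul_nonneg (h.1 _ _) (h.1 _ _)), fun x => ?_⟩
  change ∑ y : C.Out × C.Out, minusChannel C.prob x y = 1
  simp only [minusChannel]
  rw [← Finset.mul_sum, Finset.sum_comm]
  have : ∀ u : G, ∑ y : C.Out × C.Out, C.prob (x + u) y.1 * C.prob u y.2 = 1 := fun u => by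
    rw [Fintype.sum_prod_type, ← Finset.sum_mul_sum, h.2, h.2, one_mul]
  simp [this, hq]

theorem IsChannel.plus {G : Type u} [AddCommGroup G] [Fintype G] {C : Channel G}
    (h : IsChannel C.prob) : IsChannel C.plus.prob := by
  have hq : (Fintype.card G : ℝ) ≠ 0 := Nat.cast_ne_zero.mpr Fintype.card_ne_zero
  refine ⟨fun x y => mul_nonneg (mul_nonneg (by positivity) (h.1 _ _)) (h.1 _ _), fun x => ?_⟩
  change ∑ z : (C.Out × C.Out) × G, plusChannel C.prob x z = 1
  simp only [plusChannel, mul_assoc]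
  rw [← Finset.mul_sum, Fintype.sum_prod_type, Finset.sum_comm]
  have : ∀ u : G, ∑ y : C.Out × C.Out, C.prob (u + x) y.1 * C.prob x y.2 = 1 := fun u => by
    rw [Fintype.sum_prod_type, ← Finset.sum_mul_sum, h.2, h.2, one_mul]
  simp [this, hq]

theorem IsAutSymmetric.minus {G : Type u} [AddCommGroup G] [Fintype G] {C : Channel G}
    (h : IsAutSymmetric C.prob) : IsAutSymmetric C.minus.prob := by
  intro f
  obtain ⟨π, hπ⟩ := h f
  refine ⟨π.prodCongr π, fun x y => ?_⟩
  change minusChannel C.prob (f x) (π y.1, π y.2) = minusChannel C.prob x y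
  simp only [minusChannel]
  rw [← Equiv.sum_comp f.toEquiv]
  congr 1
  refine Finset.sum_congr rfl fun u _ => ?_
  change C.prob (f x + f u) _ * C.prob (f u) _ = _
  rw [← map_add, hπ, hπ]

theorem IsAutSymmetric.plus {G : Type u} [AddCommGroup G] [Fintype G] {C : Channel G}
    (h : IsAutSymmetric C.prob) : IsAutSymmetric C.plus.prob := by
  intro f
  obtain ⟨π, hπ⟩ := h f
  refine ⟨(π.prodCongr π).prodCongr f.toEquiv, fun x z => ?_⟩
  change plusChannel C.prob (f x) ((π z.1.1, π z.1.2), f z.2) = plusChannel C.prob x z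
  simp only [plusChannel]
  rw [← map_add, hπ, hπ]

theorem isChannel_and_isAutSymmetric_polar {G : Type u} [AddCommGroup G] [Fintype G]
    (s : List Bool) {C : Channel G} (hC : IsChannel C.prob) (hsym : IsAutSymmetric C.prob) :
    IsChannel (C.polar s).prob ∧ IsAutSymmetric (C.polar s).prob := by
  induction s generalizing C with
  | nil => exact ⟨hC, hsym⟩
  | cons b s ih =>
    cases b
    · exact ih hC.minus hsym.minus
    · exact ih hC.plus hsym.plus

/-- The total weight of the output `y` over the coset `x + H`. -/
def cosetSum {G : Type*} [AddCommGroup G] [Fintype G] {Y : Type*} (H : AddSubgroup G)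
    (W : G → Y → ℝ) (x : G) (y : Y) : ℝ :=
  ∑ x' : G, if x' - x ∈ H then W x' y else 0

section

variable {G : Type*} [AddCommGroup G] [Fintype G] {Y : Type*} {W : G → Y → ℝ}

theorem quotientChannel_mk (H : AddSubgroup G) (x : G) (y : Y) :
    quotientChannel H W (x : G ⧸ H) y = 1 / (Nat.card H : ℝ) * cosetSum H W x y := by
  simp only [quotientChannel, cosetSum]
  congr 1
  refine Finset.sum_congr rfl fun x' _ => if_congr ?_ rfl rfl
  rw [eq_comm, QuotientAddGroup.eq, neg_add_eq_sub]

theorem sum_quotientChannel_mul (H : AddSubgroup G) [Fintype (G ⧸ H)] (g : G ⧸ H → ℝ) (y : Y) :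
    ∑ A : G ⧸ H, quotientChannel H W A y * g A =
      1 / (Nat.card H : ℝ) * ∑ x : G, W x y * g x := by
  simp only [quotientChannel, mul_assoc, Finset.sum_mul]
  rw [← Finset.mul_sum, Finset.sum_comm]
  simp [ite_mul]

theorem card_eq_quotient_mul (H : AddSubgroup G) :
    (Fintype.card G : ℝ) = (Nat.card (G ⧸ H) : ℝ) * (Nat.card H : ℝ) := by
  rw [← Nat.card_eq_fintype_card, AddSubgroup.card_eq_card_quotient_mul_card_addSubgroup H]
  push_cast; rfl

theorem capacity_quotientChannel [Fintype Y] (H : AddSubgroup G) [Fintype (G ⧸ H)] :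
    capacity (quotientChannel H W) = ∑ y : Y, ∑ x : G, 1 / (Fintype.card G : ℝ) * W x y *
      Real.log (Fintype.card G / Nat.card H * cosetSum H W x y / ∑ x' : G, W x' y) := by
  have hq := card_eq_quotient_mul H
  have hh : (Nat.card H : ℝ) ≠ 0 := Nat.cast_ne_zero.mpr Nat.card_pos.ne'
  have hk : (Nat.card (G ⧸ H) : ℝ) ≠ 0 := Nat.cast_ne_zero.mpr Nat.card_pos.ne'
  have hsum (y : Y) : ∑ A : G ⧸ H, quotientChannel H W A y =
      1 / (Nat.card H : ℝ) * ∑ x : G, W x y := by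
    simpa using sum_quotientChannel_mul (W := W) H (fun _ => 1) y
  unfold capacity
  refine Finset.sum_congr rfl fun y _ => ?_
  simp only [hsum, mul_assoc]
  rw [← Finset.mul_sum, sum_quotientChannel_mul, ← Finset.mul_sum, ← mul_assoc,
    ← Nat.card_eq_fintype_card (α := G ⧸ H)]
  congr 1
  · rw [hq]; field_simp
  · refine Finset.sum_congr rfl fun x _ => ?_
    rw [quotientChannel_mk, hq]
    congr 2
    field_simp

theorem capacity_quotientChannel_map [Fintype Y] (hsym : IsAutSymmetric W)
    (H : AddSubgroup G) (f : G ≃+ G)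
    [Fintype (G ⧸ H)] [Fintype (G ⧸ H.map f.toAddMonoidHom)] :
    capacity (quotientChannel (H.map f.toAddMonoidHom) W) = capacity (quotientChannel H W) := by
  obtain ⟨π, hπ⟩ := hsym f
  rw [capacity_quotientChannel, capacity_quotientChannel, ← Equiv.sum_comp π]
  refine Finset.sum_congr rfl fun y _ => ?_
  rw [← Equiv.sum_comp f.toEquiv]
  refine Finset.sum_congr rfl fun x _ => ?_
  have hsum : ∑ x' : G, W x' (π y) = ∑ x' : G, W x' y := by
    rw [← Equiv.sum_comp f.toEquiv]
    exact Finset.sum_congr rfl fun x' _ => hπ x' y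
  have hcoset : cosetSum (H.map f.toAddMonoidHom) W (f x) (π y) = cosetSum H W x y := by
    simp only [cosetSum]
    rw [← Equiv.sum_comp f.toEquiv]
    refine Finset.sum_congr rfl fun x' _ => if_congr ?_ (hπ x' y) rfl
    change f x' - f x ∈ _ ↔ _
    rw [← map_sub]
    exact AddSubgroup.mem_map_iff_mem f.injective
  have hcard : Nat.card (H.map f.toAddMonoidHom) = Nat.card H :=
    AddSubgroup.card_map_of_injective f.injective
  change 1 / _ * W (f x) _ * Real.log (_ / _ * cosetSum _ W (f x) _ / _) = _
  rw [hπ, hsum, hcoset, hcard]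

theorem le_cosetSum (hW : ∀ x y, 0 ≤ W x y) (H : AddSubgroup G) (x : G) (y : Y) :
    W x y ≤ cosetSum H W x y := by
  have := Finset.single_le_sum (f := fun x' => if x' - x ∈ H then W x' y else 0)
    (fun x' _ => by split_ifs <;> simp [hW]) (Finset.mem_univ x)
  simpa [cosetSum] using this

theorem card_filter_sub_mem_le (H K : AddSubgroup G) (a b : G) :
    (Finset.univ.filter fun x : G => a - x ∈ H ∧ b - x ∈ K).card ≤
      Nat.card (H ⊓ K : AddSubgroup G) := by
  rcases (Finset.univ.filter fun x : G => a - x ∈ H ∧ b - x ∈ K).eq_empty_or_nonempty with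
    h | ⟨x₀, hx₀⟩
  · simp [h]
  · obtain ⟨ha, hb⟩ := (Finset.mem_filter.mp hx₀).2
    rw [← Nat.card_eq_finsetCard]
    refine Nat.card_le_card_of_injective
      (fun x => (⟨x.1 - x₀, ?_, ?_⟩ : (H ⊓ K : AddSubgroup G))) fun x x' hxx' => ?_
    · simpa using H.sub_mem ha (Finset.mem_filter.mp x.2).2.1
    · simpa using K.sub_mem hb (Finset.mem_filter.mp x.2).2.2
    · exact Subtype.ext (sub_left_injective (congrArg Subtype.val hxx'))

theorem sum_cosetSum_mul_le (hW : ∀ x y, 0 ≤ W x y) (H K : AddSubgroup G) (y : Y) :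
    ∑ x : G, cosetSum H W x y * cosetSum K W x y ≤
      Nat.card (H ⊓ K : AddSubgroup G) * (∑ x : G, W x y) ^ 2 := by
  calc ∑ x : G, cosetSum H W x y * cosetSum K W x y
      = ∑ a : G, ∑ b : G, W a y * W b y *
          ((Finset.univ.filter fun x : G => a - x ∈ H ∧ b - x ∈ K).card : ℝ) := by
        simp only [cosetSum, Finset.sum_mul_sum]
        rw [Finset.sum_comm]
        refine Finset.sum_congr rfl fun a _ => ?_
        rw [Finset.sum_comm]
        refine Finset.sum_congr rfl fun b _ => ?_
        rw [Finset.card_filter, Nat.cast_sum, Finset.mul_sum]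
        refine Finset.sum_congr rfl fun x _ => ?_
        by_cases h₁ : a - x ∈ H <;> by_cases h₂ : b - x ∈ K <;> simp [h₁, h₂]
    _ ≤ ∑ a : G, ∑ b : G, W a y * W b y * (Nat.card (H ⊓ K : AddSubgroup G) : ℝ) := by
        gcongr with a _ b _
        · exact mul_nonneg (hW _ _) (hW _ _)
        · exact card_filter_sub_mem_le H K a b
    _ = _ := by
        simp only [← Finset.sum_mul, ← Finset.sum_mul_sum]
        ring

/-- The pointwise form of Gibbs' inequality behind `capacity_add_le`. -/
theorem sub_le_mul_log {w a b S q h k m : ℝ} (hw : 0 ≤ w) (ha : w ≤ a) (hb : w ≤ b) (hS : w ≤ S)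
    (hq : 0 < q) (hh : 0 < h) (hk : 0 < k) (hm : 0 < m) :
    w - a * b / (S * m) ≤ w * (Real.log (w / (1 / q * S)) - Real.log (q / h * a / S)
      - Real.log (q / k * b / S) + Real.log (q * m / (h * k))) := by
  rcases hw.eq_or_lt with rfl | hw
  · simp only [zero_mul, zero_sub, neg_nonpos]; positivity
  have ha := hw.trans_le ha
  have hb := hw.trans_le hb
  have hS := hw.trans_le hS
  have hr : 0 < a * b / (S * m) / w := by positivity
  have hlog : Real.log (w / (1 / q * S)) - Real.log (q / h * a / S)
      - Real.log (q / k * b / S) + Real.log (q * m / (h * k)) =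
      -Real.log (a * b / (S * m) / w) := by
    rw [← Real.log_div (by positivity) (by positivity),
      ← Real.log_div (by positivity) (by positivity),
      ← Real.log_mul (by positivity) (by positivity), ← Real.log_inv]
    congr 1
    field_simp
  have hle := mul_le_mul_of_nonneg_left (Real.log_le_sub_one_of_pos hr) hw.le
  have hcancel : w * (a * b / (S * m) / w) = a * b / (S * m) := by field_simp
  rw [hlog]
  linarith

/-- A subadditivity estimate: the entropy of the input is at most the entropies of its classes
modulo `H` and modulo `K` plus `log |H ⊓ K|`. -/
theorem capacity_add_le [Fintype Y] (hW : IsChannel W) (H K : AddSubgroup G)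
    [Fintype (G ⧸ H)] [Fintype (G ⧸ K)] :
    capacity (quotientChannel H W) + capacity (quotientChannel K W) ≤ capacity W +
      Real.log (Fintype.card G * Nat.card (H ⊓ K : AddSubgroup G) /
        (Nat.card H * Nat.card K)) := by
  set q : ℝ := (Fintype.card G : ℝ) with hq_def
  set m : ℝ := (Nat.card (H ⊓ K : AddSubgroup G) : ℝ) with hm_def
  set L : ℝ := Real.log (q * m / (Nat.card H * Nat.card K)) with hL
  have hq : 0 < q := Nat.cast_pos.mpr Fintype.card_pos
  have hh : (0 : ℝ) < Nat.card H := Nat.cast_pos.mpr Nat.card_pos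
  have hk : (0 : ℝ) < Nat.card K := Nat.cast_pos.mpr Nat.card_pos
  have hm : 0 < m := Nat.cast_pos.mpr Nat.card_pos
  have htotal : ∑ y : Y, ∑ x : G, 1 / q * W x y = 1 := by
    rw [Finset.sum_comm]
    simp only [← Finset.mul_sum, hW.2]
    simp [← hq_def, hq.ne']
  have hL' : L = ∑ y : Y, ∑ x : G, 1 / q * W x y * L := by
    simp only [← Finset.sum_mul, htotal, one_mul]
  have key : 0 ≤ capacity W - capacity (quotientChannel H W) - capacity (quotientChannel K W)
      + L := by
    rw [capacity_quotientChannel, capacity_quotientChannel, hL', capacity]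
    simp only [← Finset.sum_sub_distrib, ← Finset.sum_add_distrib]
    refine Finset.sum_nonneg fun y _ => ?_
    set S := ∑ x : G, W x y with hS
    have hS0 : 0 ≤ S := Finset.sum_nonneg fun x _ => hW.1 x y
    have hgibbs : 0 ≤ ∑ x : G, (W x y - cosetSum H W x y * cosetSum K W x y / (S * m)) := by
      rw [Finset.sum_sub_distrib, ← Finset.sum_div, ← hS, sub_nonneg]
      rcases hS0.eq_or_lt with h0 | h0
      · simp [← h0]
      · rw [div_le_iff₀ (by positivity)]
        exact (sum_cosetSum_mul_le hW.1 H K y).trans_eq (by rw [← hS, ← hm_def]; ring)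
    refine (mul_nonneg (one_div_pos.mpr hq).le hgibbs).trans ?_
    rw [Finset.mul_sum]
    refine Finset.sum_le_sum fun x _ => ?_
    have hx := sub_le_mul_log (hW.1 x y) (le_cosetSum hW.1 H x y) (le_cosetSum hW.1 K x y)
      (Finset.single_le_sum (fun x' _ => hW.1 x' y) (Finset.mem_univ x)) hq hh hk hm
    refine (mul_le_mul_of_nonneg_left hx (one_div_pos.mpr hq).le).trans_eq ?_
    rw [← hS, ← hL]
    ring
  linarith

theorem map_eq_of_determinedBy [Fintype Y] (hW : IsChannel W) (hsym : IsAutSymmetric W)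
    {H : AddSubgroup G} {δ : ℝ} (hδ : 3 * δ ≤ Real.log 2) (hdet : DeterminedBy W H δ)
    (f : G ≃+ G) : H.map f.toAddMonoidHom = H := by
  have hcard : Nat.card (H.map f.toAddMonoidHom) = Nat.card H :=
    AddSubgroup.card_map_of_injective f.injective
  have hle := capacity_add_le hW H (H.map f.toAddMonoidHom)
  rw [capacity_quotientChannel_map hsym, hcard] at hle
  obtain ⟨h₁, h₂⟩ := hdet
  have h₁ := (abs_lt.mp h₁).2
  have h₂ := (abs_lt.mp h₂).1
  set I := H ⊓ H.map f.toAddMonoidHom with hI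
  have hIH : I ≤ H := inf_le_left
  have hh : (0 : ℝ) < Nat.card H := Nat.cast_pos.mpr Nat.card_pos
  have hm : (0 : ℝ) < Nat.card I := Nat.cast_pos.mpr Nat.card_pos
  have hk : (0 : ℝ) < Nat.card (G ⧸ H) := Nat.cast_pos.mpr Nat.card_pos
  have hlog : Real.log (Fintype.card G * Nat.card I / (Nat.card H * Nat.card H)) =
      Real.log (Nat.card (G ⧸ H)) - Real.log (Nat.card H / Nat.card I) := by
    rw [← Real.log_div (by positivity) (by positivity), card_eq_quotient_mul H]
    congr 1
    field_simp
  have hlt : Real.log (Nat.card H / Nat.card I) < Real.log 2 := by linarith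
  rw [Real.log_lt_log_iff (by positivity) two_pos, div_lt_iff₀ hm] at hlt
  have hlt : Nat.card H < 2 * Nat.card I := by exact_mod_cast hlt
  have hdvd : Nat.card I ∣ Nat.card H := AddSubgroup.card_dvd_of_le hIH
  have hcardI : Nat.card H ≤ Nat.card I := by
    obtain ⟨c, hc⟩ := hdvd
    have hc2 : c < 2 := by
      by_contra! hc2
      have := Nat.mul_le_mul_left (Nat.card I) hc2
      omega
    interval_cases c <;> omega
  have hIeq : I = H := AddSubgroup.eq_of_le_of_card_ge hIH hcardI
  have hHle : H ≤ H.map f.toAddMonoidHom := inf_eq_left.mp hIeq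
  exact (AddSubgroup.eq_of_le_of_card_ge hHle hcard.le).symm

theorem DeterminedBy.mono [Fintype Y] {H : AddSubgroup G} {δ ε : ℝ} (h : DeterminedBy W H δ)
    (hδε : δ ≤ ε) : DeterminedBy W H ε :=
  ⟨h.1.trans_le hδε, h.2.trans_le hδε⟩

end

theorem Polarizes.of_determinedBy {G : Type u} [AddCommGroup G] [Fintype G] {C : Channel G}
    {𝓗 𝓗' : Set (AddSubgroup G)} (h : Polarizes C 𝓗) {ε : ℝ} (hε : 0 < ε)
    (hmem : ∀ s, ∀ H ∈ 𝓗, DeterminedBy (C.polar s).prob H ε → H ∈ 𝓗') : Polarizes C 𝓗' := by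
  intro δ hδ
  refine tendsto_of_tendsto_of_tendsto_of_le_of_le (h (min δ ε) (lt_min hδ hε))
    tendsto_const_nhds (fun n => ?_) (fun n => ?_)
  · refine div_le_div_of_nonneg_right (Nat.cast_le.mpr (Finset.card_le_card
      fun s hs => ?_)) (by positivity)
    rw [Finset.mem_filter] at hs ⊢
    obtain ⟨-, H, hH, hdet⟩ := hs
    exact ⟨Finset.mem_univ _, H, hmem _ H hH (hdet.mono (min_le_right _ _)),
      hdet.mono (min_le_left _ _)⟩
  · refine div_le_one_of_le₀ ?_ (by positivity)
    refine (Nat.cast_le.mpr (Finset.card_le_univ _)).trans ?_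
    simp

/-- every automorphic-symmetric channel (satisfying the background
polarization property) `ℋ_ch(G)`-polarizes, where `ℋ_ch(G)` is the set of characteristic
subgroups of `G`. -/
theorem stmt_13 {G : Type u} [AddCommGroup G] [Fintype G]
    (C : Channel G) (hC : IsChannel C.prob) (hsym : IsAutSymmetric C.prob)
    (hbg : Polarizes C Set.univ) :
    Polarizes C {H : AddSubgroup G | ∀ f : G ≃+ G, H.map f.toAddMonoidHom = H} := by
  refine hbg.of_determinedBy (ε := Real.log 2 / 3) (by positivity) fun s H _ hdet => ?_
  obtain ⟨hW, hWsym⟩ := isChannel_and_isAutSymmetric_polar s hC hsym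
  exact map_eq_of_determinedBy hW hWsym (by linarith) hdet

end
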